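/- Let K be an algebraically closed field of characteristic zero, let α and β be nonzero elements of K, and let a, b, c, d be positive integers with a·d > b·c. Then the set of pairs (x, y) ∈ K × K with x ≠ 0, y ≠ 0, x^a = α·y^b and x^c = β·y^d is finite of cardinality exactly a·d − b·c. -/

import Mathlib

theorem natCard_units_pow_eq {K : Type*} [Field K] [IsAlgClosed K] [CharZero K]
    (n : ℕ) (hn : n ≠ 0) (γ : Kˣ) : Nat.card {u : Kˣ // u ^ n = γ} = n := by
  obtain ⟨x, hx⟩ := IsAlgClosed.exists_pow_nat_eq (γ : K) (Nat.pos_of_ne_zero hn)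
  have hx0 : x ≠ 0 := by
    rintro rfl
    exact γ.ne_zero (by rw [← hx, zero_pow hn])
  have hu : Units.mk0 x hx0 ^ n = γ := Units.ext (by simpa using hx)
  have : NeZero n := ⟨hn⟩
  refine (Nat.card_congr ((Equiv.mulLeft (Units.mk0 x hx0)⁻¹).subtypeEquiv fun v => ?_)).trans
    (HasEnoughRootsOfUnity.natCard_rootsOfUnity K n)
  rw [mem_rootsOfUnity, Equiv.coe_mulLeft, mul_pow, inv_pow, hu, inv_mul_eq_one, eq_comm]

theorem natCard_units_zpow_eq {K : Type*} [Field K] [IsAlgClosed K] [CharZero K]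
    (n : ℤ) (hn : n ≠ 0) (γ : Kˣ) : Nat.card {u : Kˣ // u ^ n = γ} = n.natAbs := by
  obtain ⟨m, rfl | rfl⟩ := n.eq_nat_or_neg
  · simpa using natCard_units_pow_eq m (by simpa using hn) γ
  · simpa [inv_eq_iff_eq_inv] using natCard_units_pow_eq m (by simpa using hn) γ⁻¹

/-- A binomial system on the two-dimensional torus with nonsingular exponent matrix has as many
solutions as the absolute value of the determinant. -/
theorem natCard_units_binomial_system {K : Type*} [Field K] [IsAlgClosed K] [CharZero K]
    (a c b d : ℤ) (α β : Kˣ) (h : a * d - b * c ≠ 0) :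
    Nat.card {p : Kˣ × Kˣ // p.1 ^ a * p.2 ^ b = α ∧ p.1 ^ c * p.2 ^ d = β} =
      (a * d - b * c).natAbs := by
  induction a, c using EuclideanDomain.GCD.induction generalizing b d α β with
  | H0 c =>
    have hb : b ≠ 0 := by rintro rfl; simp at h
    have hc : c ≠ 0 := by rintro rfl; simp at h
    let e : {p : Kˣ × Kˣ // p.1 ^ (0 : ℤ) * p.2 ^ b = α ∧ p.1 ^ c * p.2 ^ d = β} ≃
        Σ v : {v : Kˣ // v ^ b = α}, {u : Kˣ // u ^ c = β * (v.1 ^ d)⁻¹} :=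
      { toFun := fun p => ⟨⟨p.1.2, by simpa using p.2.1⟩,
          ⟨p.1.1, eq_mul_inv_of_mul_eq p.2.2⟩⟩
        invFun := fun q => ⟨(q.2.1, q.1.1), by simpa using q.1.2, by simp [q.2.2]⟩
        left_inv := fun _ => rfl
        right_inv := fun _ => rfl }
    have hv := natCard_units_zpow_eq b hb α
    have : Finite {v : Kˣ // v ^ b = α} :=
      Nat.finite_of_card_ne_zero (by rw [hv]; exact Int.natAbs_ne_zero.mpr hb)
    have (v : {v : Kˣ // v ^ b = α}) : Finite {u : Kˣ // u ^ c = β * (v.1 ^ d)⁻¹} :=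
      Nat.finite_of_card_ne_zero
        (by rw [natCard_units_zpow_eq c hc]; exact Int.natAbs_ne_zero.mpr hc)
    have := Fintype.ofFinite {v : Kˣ // v ^ b = α}
    rw [Nat.card_congr e, Nat.card_sigma]
    simp_rw [natCard_units_zpow_eq c hc]
    rw [Finset.sum_const, Finset.card_univ, ← Nat.card_eq_fintype_card, hv]
    simp [Int.natAbs_mul]
  | H1 a c _ ih =>
    have hdet : c % a * b - (d - c / a * b) * a = -(a * d - b * c) := by
      rw [Int.emod_def]; ring
    have key := ih (d - c / a * b) b (β * (α ^ (c / a))⁻¹) α (by rwa [hdet, neg_ne_zero])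
    rw [hdet, Int.natAbs_neg] at key
    rw [← key]
    refine Nat.card_congr (Equiv.subtypeEquivRight fun p => ?_)
    rw [and_comm]
    refine and_congr_left fun hα => ?_
    have hrow : p.1 ^ (c % a) * p.2 ^ (d - c / a * b) =
        p.1 ^ c * p.2 ^ d * (α ^ (c / a))⁻¹ := by
      rw [← hα, mul_zpow, ← zpow_mul, ← zpow_mul, Int.emod_def, zpow_sub, zpow_sub,
        mul_comm b, mul_inv, mul_mul_mul_comm]
    rw [hrow, mul_left_inj]

/-- Let `K` be an algebraically closed field of characteristic zero, `α, β` nonzero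
elements of `K`, and `a, b, c, d` positive integers with `a·d > b·c`.  Then the set of
pairs `(x, y) ∈ K × K` with `x ≠ 0`, `y ≠ 0`, `x^a = α·y^b` and `x^c = β·y^d` is finite
of cardinality exactly `a·d − b·c`. -/
theorem torus_roots_card (K : Type*) [Field K] [IsAlgClosed K] [CharZero K]
    (α β : K) (hα : α ≠ 0) (hβ : β ≠ 0)
    (a b c d : ℕ) (ha : 0 < a) (hb : 0 < b) (hc : 0 < c) (hd : 0 < d)
    (habcd : b * c < a * d) :
    {p : K × K | p.1 ≠ 0 ∧ p.2 ≠ 0 ∧ p.1 ^ a = α * p.2 ^ b ∧ p.1 ^ c = β * p.2 ^ d}.Finite ∧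
    {p : K × K | p.1 ≠ 0 ∧ p.2 ≠ 0 ∧ p.1 ^ a = α * p.2 ^ b ∧ p.1 ^ c = β * p.2 ^ d}.ncard
      = a * d - b * c := by
  set S := {p : K × K | p.1 ≠ 0 ∧ p.2 ≠ 0 ∧ p.1 ^ a = α * p.2 ^ b ∧ p.1 ^ c = β * p.2 ^ d}
  let T : Set (Kˣ × Kˣ) := {p | p.1 ^ (a : ℤ) * p.2 ^ (-b : ℤ) = Units.mk0 α hα ∧
    p.1 ^ (c : ℤ) * p.2 ^ (-d : ℤ) = Units.mk0 β hβ}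
  have hiff (u v γ : Kˣ) (m n : ℕ) :
      u ^ (m : ℤ) * v ^ (-n : ℤ) = γ ↔ (u : K) ^ m = γ * (v : K) ^ n := by
    rw [zpow_neg, mul_inv_eq_iff_eq_mul, Units.ext_iff]
    simp
  have hST : S = Prod.map Units.val Units.val '' T := by
    ext ⟨x, y⟩
    constructor
    · rintro ⟨hx, hy, h₁, h₂⟩
      exact ⟨(Units.mk0 x hx, Units.mk0 y hy), ⟨(hiff _ _ _ _ _).2 h₁, (hiff _ _ _ _ _).2 h₂⟩, rfl⟩
    · rintro ⟨⟨u, v⟩, ⟨h₁, h₂⟩, h⟩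
      obtain ⟨rfl, rfl⟩ := Prod.mk.inj h
      exact ⟨u.ne_zero, v.ne_zero, (hiff _ _ _ _ _).1 h₁, (hiff _ _ _ _ _).1 h₂⟩
  have hlt : (b * c : ℤ) < a * d := by exact_mod_cast habcd
  have hcard : S.ncard = a * d - b * c := by
    rw [hST, Set.ncard_image_of_injective _ (Units.val_injective.prodMap Units.val_injective),
      ← Nat.card_coe_set_eq]
    refine (natCard_units_binomial_system (a : ℤ) c (-b) (-d) _ _ (by linarith)).trans ?_
    zify [habcd.le]
    rw [abs_of_neg (by linarith)]
    ring
  exact ⟨Set.finite_of_ncard_pos (hcard ▸ Nat.sub_pos_of_lt habcd), hcard⟩
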